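/- Let β ∈ (−1, 1), μ₊, μ₋ ∈ ℝ, q > 0, x ≤ 0 and y < 0. Define p(t; x, y) := φ_t(y − x; μ₋) − e^{2 μ₋ y} φ_t(−x − y; μ₋) + 2(1−β) e^{2 μ₋ y} ∫₀^∞ ∫₀^t h(τ; (1+β) b, μ₊) · h(t − τ; (1−β) b − y − x, −μ₋) dτ db. Then ∫₀^∞ e^{−q t} p(t; x, y) dt = (e^{μ₋ (y − x)}/√(μ₋² + 2q)) · ( e^{−|y − x| √(μ₋² + 2q)} − e^{(x + y) √(μ₋² + 2q)} ) + (2(1−β)/D(q)) · e^{μ₋ (y − x) + (x + y) √(μ₋² + 2q)}. -/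

import Mathlib

open MeasureTheory Real Set Filter

/-- The auxiliary density `h(t; x, μ) = |x| / √(2π t³) · exp(−(x + μ t)² / (2t))`. -/
noncomputable def h (t x μ : ℝ) : ℝ :=
  |x| / Real.sqrt (2 * Real.pi * t ^ 3) * Real.exp (-(x + μ * t) ^ 2 / (2 * t))

/-- Gaussian density with drift: `φ_t(z; μ) = (1/√(2π t)) exp(−(z − μ t)²/(2t))`. -/
noncomputable def phi (t z μ : ℝ) : ℝ :=
  1 / Real.sqrt (2 * Real.pi * t) * Real.exp (-(z - μ * t) ^ 2 / (2 * t))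

/-- `D(q) = (1+β)(μ₊ + √(2q+μ₊²)) + (1−β)(−μ₋ + √(2q+μ₋²))`. -/
noncomputable def D (β μp μm q : ℝ) : ℝ :=
  (1 + β) * (μp + Real.sqrt (2 * q + μp ^ 2)) + (1 - β) * (-μm + Real.sqrt (2 * q + μm ^ 2))

open Topology

/-- The Gaussian primitive `u ↦ ∫₀ᵘ exp (-v² / 2) dv`. -/
noncomputable def gaussPrimitive (u : ℝ) : ℝ := ∫ v in (0 : ℝ)..u, Real.exp (-(1 / 2) * v ^ 2)

lemma hasDerivAt_gaussPrimitive (u : ℝ) :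
    HasDerivAt gaussPrimitive (Real.exp (-(1 / 2) * u ^ 2)) u := by
  have hc : Continuous fun v : ℝ => Real.exp (-(1 / 2) * v ^ 2) := by fun_prop
  exact intervalIntegral.integral_hasDerivAt_right (hc.intervalIntegrable _ _)
    hc.stronglyMeasurable.stronglyMeasurableAtFilter hc.continuousAt

lemma gaussPrimitive_neg (u : ℝ) : gaussPrimitive (-u) = -gaussPrimitive u := by
  have key := intervalIntegral.integral_comp_neg (a := 0) (b := u)
    (fun v : ℝ => Real.exp (-(1 / 2) * v ^ 2))
  simp only [neg_zero, even_two, Even.neg_pow] at key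
  rw [gaussPrimitive, gaussPrimitive, key, intervalIntegral.integral_symm]

lemma tendsto_gaussPrimitive_atTop :
    Tendsto gaussPrimitive atTop (𝓝 (√(2 * π) / 2)) := by
  have key := intervalIntegral_tendsto_integral_Ioi 0
    (integrable_exp_neg_mul_sq (b := 1 / 2) (by norm_num)).integrableOn tendsto_id
  rw [integral_gaussian_Ioi, show π / (1 / 2) = 2 * π by ring] at key
  exact key

lemma tendsto_gaussPrimitive_atBot :
    Tendsto gaussPrimitive atBot (𝓝 (-(√(2 * π) / 2))) := by
  have key := (tendsto_gaussPrimitive_atTop.comp tendsto_neg_atBot_atTop).neg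
  refine key.congr fun u => ?_
  simp [gaussPrimitive_neg]

/-- A nonnegative function with a primitive having limits at both ends of `(a, ∞)` is integrable
there, and its integral is the difference of the limits. -/
lemma integral_Ioi_of_nonneg_of_tendsto_nhdsGT {g g' : ℝ → ℝ} {a l₀ l : ℝ}
    (hderiv : ∀ t ∈ Ioi a, HasDerivAt g (g' t) t) (hpos : ∀ t ∈ Ioi a, 0 ≤ g' t)
    (h₀ : Tendsto g (𝓝[>] a) (𝓝 l₀)) (hl : Tendsto g atTop (𝓝 l)) :
    IntegrableOn g' (Ioi a) ∧ ∫ t in Ioi a, g' t = l - l₀ := by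
  have hcont : ContinuousWithinAt (Function.update g a l₀) (Ici a) a := by
    rw [continuousWithinAt_update_same, Ici_sdiff_left]
    exact h₀
  have hder : ∀ t ∈ Ioi a, HasDerivAt (Function.update g a l₀) (g' t) t := by
    intro t ht
    refine (hderiv t ht).congr_of_eventuallyEq ?_
    filter_upwards [Ioi_mem_nhds ht] with r hr
    exact Function.update_of_ne (ne_of_gt hr) _ _
  have hlim : Tendsto (Function.update g a l₀) atTop (𝓝 l) := by
    refine hl.congr' ?_
    filter_upwards [Ioi_mem_atTop a] with r hr
    exact (Function.update_of_ne (ne_of_gt hr) _ _).symm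
  refine ⟨integrableOn_Ioi_deriv_of_nonneg hcont hder hpos hlim, ?_⟩
  rw [integral_Ioi_of_hasDerivAt_of_nonneg hcont hder hpos hlim, Function.update_self]

lemma hasDerivAt_gaussPrimitive_comp (c s : ℝ) {t : ℝ} (ht : 0 < t) :
    HasDerivAt (fun r => Real.exp (c * s) * gaussPrimitive (s * √r + c * (√r)⁻¹))
      (Real.exp (-(c ^ 2 / t + s ^ 2 * t) / 2) * (s / √t - c / √t ^ 3) / 2) t := by
  have hst : 0 < √t := Real.sqrt_pos.2 ht
  have hs := Real.hasDerivAt_sqrt ht.ne'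
  have hu := (hs.const_mul s).add ((hs.inv hst.ne').const_mul c)
  have key := ((hasDerivAt_gaussPrimitive (s * √t + c * (√t)⁻¹)).comp t hu).const_mul
    (Real.exp (c * s))
  refine key.congr_deriv ?_
  rw [← mul_assoc, ← Real.exp_add]
  have hE : c * s + -(1 / 2) * (s * √t + c * (√t)⁻¹) ^ 2 = -(c ^ 2 / t + s ^ 2 * t) / 2 := by
    obtain ⟨r, hr, rfl⟩ : ∃ r, 0 < r ∧ t = r ^ 2 := ⟨√t, hst, (Real.sq_sqrt ht.le).symm⟩
    rw [Real.sqrt_sq hr.le]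
    field_simp
    ring
  rw [hE]
  field_simp
  ring

lemma tendsto_mul_sqrt_add_atTop (c : ℝ) {s : ℝ} (hs : 0 < s) :
    Tendsto (fun r => s * √r + c * (√r)⁻¹) atTop atTop := by
  exact (Real.tendsto_sqrt_atTop.const_mul_atTop hs).atTop_add
    ((tendsto_inv_atTop_zero.comp Real.tendsto_sqrt_atTop).const_mul c)

lemma tendsto_sqrt_nhdsGT_zero : Tendsto Real.sqrt (𝓝[>] 0) (𝓝[>] 0) := by
  refine tendsto_nhdsWithin_iff.2 ⟨?_, ?_⟩
  · exact ((Real.continuous_sqrt.tendsto' 0 0 Real.sqrt_zero)).mono_left nhdsWithin_le_nhds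
  · filter_upwards [self_mem_nhdsWithin] with t ht using Real.sqrt_pos.2 ht

lemma tendsto_mul_sqrt_nhdsGT_zero (s : ℝ) : Tendsto (fun r => s * √r) (𝓝[>] 0) (𝓝 0) := by
  simpa using (tendsto_sqrt_nhdsGT_zero.mono_right nhdsWithin_le_nhds).const_mul s

lemma tendsto_mul_sqrt_add_nhdsGT_zero_of_pos {c : ℝ} (s : ℝ) (hc : 0 < c) :
    Tendsto (fun r => s * √r + c * (√r)⁻¹) (𝓝[>] 0) atTop :=
  (tendsto_mul_sqrt_nhdsGT_zero s).add_atTop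
    ((tendsto_inv_nhdsGT_zero.comp tendsto_sqrt_nhdsGT_zero).const_mul_atTop hc)

lemma tendsto_mul_sqrt_add_nhdsGT_zero_of_neg {c : ℝ} (s : ℝ) (hc : c < 0) :
    Tendsto (fun r => s * √r + c * (√r)⁻¹) (𝓝[>] 0) atBot :=
  (tendsto_mul_sqrt_nhdsGT_zero s).add_atBot
    ((tendsto_inv_nhdsGT_zero.comp tendsto_sqrt_nhdsGT_zero).const_mul_atTop_of_neg hc)

/-- `∫₀^∞ exp (-(c²/t + s² t)/2) s/√t dt = √(2π) exp (-c s)` for `c ≥ 0`, `s > 0`. -/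
lemma integral_exp_mul_div_sqrt {c s : ℝ} (hc : 0 ≤ c) (hs : 0 < s) :
    IntegrableOn (fun t => Real.exp (-(c ^ 2 / t + s ^ 2 * t) / 2) * (s / √t)) (Ioi 0) ∧
      ∫ t in Ioi 0, Real.exp (-(c ^ 2 / t + s ^ 2 * t) / 2) * (s / √t) =
        √(2 * π) * Real.exp (-(c * s)) := by
  have hderiv : ∀ t ∈ Ioi (0 : ℝ), HasDerivAt
      (fun r => Real.exp (c * s) * gaussPrimitive (s * √r + c * (√r)⁻¹) +
        Real.exp (-c * s) * gaussPrimitive (s * √r + -c * (√r)⁻¹))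
      (Real.exp (-(c ^ 2 / t + s ^ 2 * t) / 2) * (s / √t)) t := fun t ht =>
    ((hasDerivAt_gaussPrimitive_comp c s ht).add
      (hasDerivAt_gaussPrimitive_comp (-c) s ht)).congr_deriv (by rw [neg_sq]; ring)
  have hpos : ∀ t ∈ Ioi (0 : ℝ), 0 ≤ Real.exp (-(c ^ 2 / t + s ^ 2 * t) / 2) * (s / √t) :=
    fun t _ => by positivity
  have htop := ((tendsto_gaussPrimitive_atTop.comp (tendsto_mul_sqrt_add_atTop c hs)).const_mul
    (Real.exp (c * s))).add ((tendsto_gaussPrimitive_atTop.comp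
      (tendsto_mul_sqrt_add_atTop (-c) hs)).const_mul (Real.exp (-c * s)))
  rcases hc.eq_or_lt with rfl | hc
  · have h₀ : Tendsto (fun r => gaussPrimitive (s * √r)) (𝓝[>] 0) (𝓝 0) := by
      have := (hasDerivAt_gaussPrimitive 0).continuousAt.tendsto.comp
        (tendsto_mul_sqrt_nhdsGT_zero s)
      rwa [gaussPrimitive, intervalIntegral.integral_same] at this
    have := integral_Ioi_of_nonneg_of_tendsto_nhdsGT hderiv hpos (l₀ := 0)
      (by simpa using h₀.add h₀) htop
    refine ⟨this.1, this.2.trans ?_⟩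
    simp
  · have h₀ := ((tendsto_gaussPrimitive_atTop.comp
      (tendsto_mul_sqrt_add_nhdsGT_zero_of_pos s hc)).const_mul
      (Real.exp (c * s))).add ((tendsto_gaussPrimitive_atBot.comp
      (tendsto_mul_sqrt_add_nhdsGT_zero_of_neg s (neg_lt_zero.2 hc))).const_mul
        (Real.exp (-c * s)))
    have := integral_Ioi_of_nonneg_of_tendsto_nhdsGT hderiv hpos h₀ htop
    refine ⟨this.1, this.2.trans ?_⟩
    rw [neg_mul]
    ring

/-- `∫₀^∞ exp (-(c²/t + s² t)/2) c/√t³ dt = √(2π) exp (-c s)` for `c, s > 0`. -/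
lemma integral_exp_mul_div_sqrt_pow {c s : ℝ} (hc : 0 < c) (hs : 0 < s) :
    IntegrableOn (fun t => Real.exp (-(c ^ 2 / t + s ^ 2 * t) / 2) * (c / √t ^ 3)) (Ioi 0) ∧
      ∫ t in Ioi 0, Real.exp (-(c ^ 2 / t + s ^ 2 * t) / 2) * (c / √t ^ 3) =
        √(2 * π) * Real.exp (-(c * s)) := by
  have hderiv : ∀ t ∈ Ioi (0 : ℝ), HasDerivAt
      (fun r => Real.exp (-c * s) * gaussPrimitive (s * √r + -c * (√r)⁻¹) -
        Real.exp (c * s) * gaussPrimitive (s * √r + c * (√r)⁻¹))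
      (Real.exp (-(c ^ 2 / t + s ^ 2 * t) / 2) * (c / √t ^ 3)) t := fun t ht =>
    ((hasDerivAt_gaussPrimitive_comp (-c) s ht).sub
      (hasDerivAt_gaussPrimitive_comp c s ht)).congr_deriv (by rw [neg_sq]; ring)
  have hpos : ∀ t ∈ Ioi (0 : ℝ), 0 ≤ Real.exp (-(c ^ 2 / t + s ^ 2 * t) / 2) * (c / √t ^ 3) :=
    fun t _ => by positivity
  have htop := ((tendsto_gaussPrimitive_atTop.comp
      (tendsto_mul_sqrt_add_atTop (-c) hs)).const_mul (Real.exp (-c * s))).sub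
      ((tendsto_gaussPrimitive_atTop.comp (tendsto_mul_sqrt_add_atTop c hs)).const_mul
    (Real.exp (c * s)))
  have h₀ := ((tendsto_gaussPrimitive_atBot.comp
      (tendsto_mul_sqrt_add_nhdsGT_zero_of_neg s (neg_lt_zero.2 hc))).const_mul
        (Real.exp (-c * s))).sub ((tendsto_gaussPrimitive_atTop.comp
      (tendsto_mul_sqrt_add_nhdsGT_zero_of_pos s hc)).const_mul
      (Real.exp (c * s)))
  have := integral_Ioi_of_nonneg_of_tendsto_nhdsGT hderiv hpos h₀ htop
  refine ⟨this.1, this.2.trans ?_⟩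
  rw [neg_mul]
  ring

lemma sq_sqrt_sq_add {q : ℝ} (hq : 0 < q) (μ : ℝ) : √(μ ^ 2 + 2 * q) ^ 2 = μ ^ 2 + 2 * q :=
  Real.sq_sqrt (by positivity)

/-- Laplace transform of the drifted Gaussian density in time. -/
lemma laplace_phi {q : ℝ} (hq : 0 < q) (z μ : ℝ) :
    IntegrableOn (fun t => Real.exp (-q * t) * phi t z μ) (Ioi 0) ∧
      ∫ t in Ioi 0, Real.exp (-q * t) * phi t z μ =
        Real.exp (μ * z) / √(μ ^ 2 + 2 * q) * Real.exp (-|z| * √(μ ^ 2 + 2 * q)) := by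
  have hs : 0 < √(μ ^ 2 + 2 * q) := Real.sqrt_pos.2 (by positivity)
  have hs2 := sq_sqrt_sq_add hq μ
  set s := √(μ ^ 2 + 2 * q)
  have heq : EqOn (fun t => Real.exp (μ * z) / (√(2 * π) * s) *
      (Real.exp (-(|z| ^ 2 / t + s ^ 2 * t) / 2) * (s / √t)))
      (fun t => Real.exp (-q * t) * phi t z μ) (Ioi 0) := by
    intro t ht
    have ht : 0 < t := ht
    have hexp : Real.exp (-q * t) * Real.exp (-(z - μ * t) ^ 2 / (2 * t)) =
        Real.exp (μ * z) * Real.exp (-(|z| ^ 2 / t + s ^ 2 * t) / 2) := by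
      rw [← Real.exp_add, ← Real.exp_add, hs2, sq_abs]
      congr 1
      field_simp
      ring
    simp only [phi]
    rw [Real.sqrt_mul (x := 2 * π) (by positivity) t]
    calc _ = 1 / (√(2 * π) * √t) * (Real.exp (μ * z) *
          Real.exp (-(|z| ^ 2 / t + s ^ 2 * t) / 2)) := by
            have : 0 < √(2 * π) := by positivity
            field_simp
      _ = _ := by rw [← hexp]; ring
  obtain ⟨hi, hv⟩ := integral_exp_mul_div_sqrt (abs_nonneg z) hs
  refine ⟨IntegrableOn.congr_fun (hi.const_mul _) heq measurableSet_Ioi, ?_⟩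
  rw [← setIntegral_congr_fun measurableSet_Ioi heq, integral_const_mul, hv, neg_mul]
  have : 0 < √(2 * π) := by positivity
  field_simp

/-- Laplace transform of the first-passage density `h`. -/
lemma laplace_h {q x : ℝ} (hq : 0 < q) (hx : 0 < x) (μ : ℝ) :
    IntegrableOn (fun t => Real.exp (-q * t) * h t x μ) (Ioi 0) ∧
      ∫ t in Ioi 0, Real.exp (-q * t) * h t x μ =
        Real.exp (-(x * (μ + √(2 * q + μ ^ 2)))) := by
  have hs : 0 < √(μ ^ 2 + 2 * q) := Real.sqrt_pos.2 (by positivity)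
  have hs2 := sq_sqrt_sq_add hq μ
  rw [add_comm (2 * q)]
  set s := √(μ ^ 2 + 2 * q)
  have heq : EqOn (fun t => Real.exp (-(μ * x)) / √(2 * π) *
      (Real.exp (-(x ^ 2 / t + s ^ 2 * t) / 2) * (x / √t ^ 3)))
      (fun t => Real.exp (-q * t) * h t x μ) (Ioi 0) := by
    intro t ht
    have ht : 0 < t := ht
    have hexp : Real.exp (-q * t) * Real.exp (-(x + μ * t) ^ 2 / (2 * t)) =
        Real.exp (-(μ * x)) * Real.exp (-(x ^ 2 / t + s ^ 2 * t) / 2) := by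
      rw [← Real.exp_add, ← Real.exp_add, hs2]
      congr 1
      field_simp
      ring
    have h3 : √(t ^ 3) = √t ^ 3 := by
      rw [Real.sqrt_eq_iff_mul_self_eq (by positivity) (by positivity)]
      rw [← mul_pow, Real.mul_self_sqrt ht.le]
    simp only [h]
    rw [Real.sqrt_mul (x := 2 * π) (by positivity) (t ^ 3), h3, abs_of_pos hx]
    calc _ = x / (√(2 * π) * √t ^ 3) * (Real.exp (-(μ * x)) *
          Real.exp (-(x ^ 2 / t + s ^ 2 * t) / 2)) := by
            have : 0 < √(2 * π) := by positivity
            field_simp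
      _ = _ := by rw [← hexp]; ring
  obtain ⟨hi, hv⟩ := integral_exp_mul_div_sqrt_pow hx hs
  refine ⟨IntegrableOn.congr_fun (hi.const_mul _) heq measurableSet_Ioi, ?_⟩
  rw [← setIntegral_congr_fun measurableSet_Ioi heq, integral_const_mul, hv]
  have : 0 < √(2 * π) := by positivity
  rw [show -(x * (μ + s)) = -(μ * x) + -(x * s) by ring, Real.exp_add]
  field_simp

lemma h_nonneg (t x μ : ℝ) : 0 ≤ h t x μ := by
  unfold h
  positivity

/-- Laplace transform of the convolution of two first-passage densities. -/
lemma laplace_convolution_h {q x x' : ℝ} (hq : 0 < q) (hx : 0 < x) (hx' : 0 < x') (μ ν : ℝ) :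
    IntegrableOn (fun t => Real.exp (-q * t) * ∫ τ in (0 : ℝ)..t, h τ x μ * h (t - τ) x' ν)
        (Ioi 0) ∧
      ∫ t in Ioi 0, Real.exp (-q * t) * ∫ τ in (0 : ℝ)..t, h τ x μ * h (t - τ) x' ν =
        Real.exp (-(x * (μ + √(2 * q + μ ^ 2)))) * Real.exp (-(x' * (ν + √(2 * q + ν ^ 2)))) := by
  obtain ⟨hi, hv⟩ := laplace_h hq hx μ
  obtain ⟨hi', hv'⟩ := laplace_h hq hx' ν
  have heq : ∀ t : ℝ, ∫ τ in (0 : ℝ)..t, (ContinuousLinearMap.mul ℝ ℝ)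
      (Real.exp (-q * τ) * h τ x μ) (Real.exp (-q * (t - τ)) * h (t - τ) x' ν) =
      Real.exp (-q * t) * ∫ τ in (0 : ℝ)..t, h τ x μ * h (t - τ) x' ν := by
    intro t
    rw [← intervalIntegral.integral_const_mul]
    refine intervalIntegral.integral_congr fun τ _ => ?_
    simp only [ContinuousLinearMap.mul_apply']
    rw [show -q * t = -q * τ + -q * (t - τ) by ring, Real.exp_add]
    ring
  constructor
  · refine (integrable_posConvolution hi hi' (ContinuousLinearMap.mul ℝ ℝ)).integrableOn.congr_fun
      (fun t ht => ?_) measurableSet_Ioi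
    rw [← heq, posConvolution, indicator_of_mem ht]
  · have key := integral_posConvolution hi hi' (ContinuousLinearMap.mul ℝ ℝ)
    simp only [heq] at key
    rw [key, hv, hv', ContinuousLinearMap.mul_apply']

lemma stronglyMeasurable_setIntegral_Ioc {α : Type*} [MeasurableSpace α] {f : α → ℝ → ℝ}
    {u v : α → ℝ} (hf : StronglyMeasurable (Function.uncurry f)) (hu : Measurable u)
    (hv : Measurable v) : StronglyMeasurable fun p => ∫ τ in Ioc (u p) (v p), f p τ := by
  simp only [← integral_indicator measurableSet_Ioc]
  have hset : MeasurableSet {z : α × ℝ | z.2 ∈ Ioc (u z.1) (v z.1)} :=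
    (measurableSet_lt (hu.comp measurable_fst) measurable_snd).inter
      (measurableSet_le measurable_snd (hv.comp measurable_fst))
  have key := (hf.indicator hset).integral_prod_right' (ν := volume)
  exact key

/-- Laplace transform of the mixture over `b` of convolutions of first-passage densities. -/
lemma laplace_integral_convolution_h {q a k d : ℝ} (hq : 0 < q) (ha : 0 < a) (hk : 0 ≤ k)
    (hd : 0 < d) (μ ν : ℝ) :
    IntegrableOn (fun t => Real.exp (-q * t) * ∫ b in Ioi (0 : ℝ), ∫ τ in (0 : ℝ)..t,
        h τ (a * b) μ * h (t - τ) (k * b + d) ν) (Ioi 0) ∧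
      ∫ t in Ioi 0, Real.exp (-q * t) * ∫ b in Ioi (0 : ℝ), ∫ τ in (0 : ℝ)..t,
        h τ (a * b) μ * h (t - τ) (k * b + d) ν =
        Real.exp (-(d * (ν + √(2 * q + ν ^ 2)))) /
          (a * (μ + √(2 * q + μ ^ 2)) + k * (ν + √(2 * q + ν ^ 2))) := by
  have hpos : ∀ m : ℝ, 0 < m + √(2 * q + m ^ 2) := by
    intro m
    have : |m| < √(2 * q + m ^ 2) := by
      rw [← Real.sqrt_sq_eq_abs]
      exact Real.sqrt_lt_sqrt (sq_nonneg m) (by linarith)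
    linarith [neg_abs_le m]
  have hA := hpos μ
  have hB := hpos ν
  set A := μ + √(2 * q + μ ^ 2) with hAdef
  set B := ν + √(2 * q + ν ^ 2) with hBdef
  have hC : 0 < a * A + k * B := by positivity
  set F : ℝ → ℝ → ℝ := fun b t => Real.exp (-q * t) * ∫ τ in (0 : ℝ)..t,
    h τ (a * b) μ * h (t - τ) (k * b + d) ν with hF
  have hmeas : StronglyMeasurable (Function.uncurry F) := by
    have hH : StronglyMeasurable (Function.uncurry fun (p : ℝ × ℝ) (τ : ℝ) =>
        h τ (a * p.1) μ * h (p.2 - τ) (k * p.1 + d) ν) := by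
      refine Measurable.stronglyMeasurable ?_
      unfold h Function.uncurry
      fun_prop
    have hexp : StronglyMeasurable fun p : ℝ × ℝ => Real.exp (-q * p.2) := by
      refine Measurable.stronglyMeasurable ?_
      fun_prop
    exact hexp.mul ((stronglyMeasurable_setIntegral_Ioc hH measurable_const measurable_snd).sub
      (stronglyMeasurable_setIntegral_Ioc hH measurable_snd measurable_const))
  have hFint : ∀ b ∈ Ioi (0 : ℝ), IntegrableOn (F b) (Ioi 0) ∧
      ∫ t in Ioi 0, F b t = Real.exp (-(d * B)) * Real.exp (-(a * A + k * B) * b) := by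
    intro b hb
    have hb : 0 < b := hb
    obtain ⟨hi, hv⟩ := laplace_convolution_h hq (mul_pos ha hb)
      (show 0 < k * b + d by positivity) μ ν
    refine ⟨hi, hv.trans ?_⟩
    rw [← hAdef, ← hBdef, ← Real.exp_add, ← Real.exp_add]
    congr 1
    ring
  have hFnonneg : ∀ b, ∀ t ∈ Ioi (0 : ℝ), 0 ≤ F b t := fun b t ht =>
    mul_nonneg (Real.exp_nonneg _) (intervalIntegral.integral_nonneg (le_of_lt ht)
      fun τ _ => mul_nonneg (h_nonneg _ _ _) (h_nonneg _ _ _))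
  have hexpint : IntegrableOn
      (fun b => Real.exp (-(d * B)) * Real.exp (-(a * A + k * B) * b)) (Ioi 0) :=
    (integrableOn_exp_mul_Ioi (neg_lt_zero.2 hC) 0).const_mul _
  have hprod : Integrable (Function.uncurry F)
      ((volume.restrict (Ioi (0 : ℝ))).prod (volume.restrict (Ioi (0 : ℝ)))) := by
    rw [integrable_prod_iff hmeas.aestronglyMeasurable]
    refine ⟨ae_restrict_of_forall_mem measurableSet_Ioi fun b hb => (hFint b hb).1, ?_⟩
    refine IntegrableOn.congr_fun hexpint (fun b hb => ?_) measurableSet_Ioi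
    rw [← (hFint b hb).2]
    refine setIntegral_congr_fun measurableSet_Ioi fun t ht => ?_
    exact (Real.norm_of_nonneg (hFnonneg b t ht)).symm
  have heq : ∀ t : ℝ, Real.exp (-q * t) * ∫ b in Ioi (0 : ℝ), ∫ τ in (0 : ℝ)..t,
      h τ (a * b) μ * h (t - τ) (k * b + d) ν = ∫ b in Ioi 0, F b t := fun t =>
    (integral_const_mul _ _).symm
  simp only [heq]
  refine ⟨hprod.integral_prod_right, ?_⟩
  rw [← integral_integral_swap hprod,
    setIntegral_congr_fun measurableSet_Ioi fun b hb => (hFint b hb).2, integral_const_mul,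
    integral_exp_mul_Ioi (neg_lt_zero.2 hC), mul_zero, Real.exp_zero]
  field_simp

/-- Laplace transform in `t` of the transition density `p(t; x, y)` of refracted skew
Brownian motion for `x ≤ 0` and `y < 0`. -/
theorem laplace_p_xneg_yneg (β μp μm q x y : ℝ)
    (hβ : β ∈ Ioo (-1 : ℝ) 1) (hq : 0 < q) (hx : x ≤ 0) (hy : y < 0) :
    ∫ t in Ioi (0 : ℝ), Real.exp (-q * t) *
        (phi t (y - x) μm - Real.exp (2 * μm * y) * phi t (-x - y) μm
          + 2 * (1 - β) * Real.exp (2 * μm * y) *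
            ∫ b in Ioi (0 : ℝ), ∫ τ in (0 : ℝ)..t,
              h τ ((1 + β) * b) μp * h (t - τ) ((1 - β) * b - y - x) (-μm))
      = Real.exp (μm * (y - x)) / Real.sqrt (μm ^ 2 + 2 * q) *
            (Real.exp (-|y - x| * Real.sqrt (μm ^ 2 + 2 * q))
              - Real.exp ((x + y) * Real.sqrt (μm ^ 2 + 2 * q)))
        + 2 * (1 - β) / D β μp μm q *
            Real.exp (μm * (y - x) + (x + y) * Real.sqrt (μm ^ 2 + 2 * q)) := by
  obtain ⟨hβ₁, hβ₂⟩ := hβ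
  obtain ⟨hi₁, hv₁⟩ := laplace_phi hq (y - x) μm
  obtain ⟨hi₂, hv₂⟩ := laplace_phi hq (-x - y) μm
  obtain ⟨hi₃, hv₃⟩ := laplace_integral_convolution_h hq (show 0 < 1 + β by linarith)
    (show 0 ≤ 1 - β by linarith) (show 0 < -y - x by linarith) μp (-μm)
  have hsub : ∀ b : ℝ, (1 - β) * b - y - x = (1 - β) * b + (-y - x) := fun b => by ring
  simp only [hsub]
  have hsplit : ∀ t : ℝ, Real.exp (-q * t) *
      (phi t (y - x) μm - Real.exp (2 * μm * y) * phi t (-x - y) μm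
        + 2 * (1 - β) * Real.exp (2 * μm * y) *
          ∫ b in Ioi (0 : ℝ), ∫ τ in (0 : ℝ)..t,
            h τ ((1 + β) * b) μp * h (t - τ) ((1 - β) * b + (-y - x)) (-μm)) =
      Real.exp (-q * t) * phi t (y - x) μm
        - Real.exp (2 * μm * y) * (Real.exp (-q * t) * phi t (-x - y) μm)
        + 2 * (1 - β) * Real.exp (2 * μm * y) * (Real.exp (-q * t) *
          ∫ b in Ioi (0 : ℝ), ∫ τ in (0 : ℝ)..t,
            h τ ((1 + β) * b) μp * h (t - τ) ((1 - β) * b + (-y - x)) (-μm)) := fun t => by ring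
  simp only [hsplit]
  have hi₂' := hi₂.const_mul (Real.exp (2 * μm * y))
  have hi₃' := hi₃.const_mul (2 * (1 - β) * Real.exp (2 * μm * y))
  rw [integral_add (by exact hi₁.sub hi₂') hi₃', integral_sub hi₁ hi₂', integral_const_mul, integral_const_mul, hv₁, hv₂, hv₃,
    abs_of_pos (show 0 < -x - y by linarith), neg_sq, D, add_comm (2 * q) (μm ^ 2)]
  set s := √(μm ^ 2 + 2 * q)
  have hexp₁ : Real.exp (2 * μm * y) * Real.exp (μm * (-x - y)) = Real.exp (μm * (y - x)) := by
    rw [← Real.exp_add]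
    congr 1
    ring
  have hexp₂ : Real.exp (2 * μm * y) * Real.exp (-((-y - x) * (-μm + s))) =
      Real.exp (μm * (y - x) + (x + y) * s) := by
    rw [← Real.exp_add]
    congr 1
    ring
  rw [← hexp₁, ← hexp₂, show -(-x - y) * s = (x + y) * s by ring]
  ring
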